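/- Let α ∈ [0,1], let n ≥ 1 be a natural number, let z_t, N_t, N^c_t, N^d_t (t = 1, …, n) be real numbers, let b₁, b₂ ≥ 0, and let β₁, β₂ ∈ ℝ satisfy |β₁| ≤ b₁ and |β₂| ≤ b₂. Define the perturbed residuals z'_t = z_t + N_t − β₁·N^c_t − β₂·N^d_t and set S = max_{1 ≤ t ≤ n} (|N_t| + b₁|N^c_t| + b₂|N^d_t|). Then |(1/n)·Σ_{t=1}^n ρ_α(z'_t) − (1/n)·Σ_{t=1}^n ρ_α(z_t)| ≤ (1/n)·Σ_{t=1}^n (|N_t| + b₁|N^c_t| + b₂|N^d_t|) + (1/n)·Σ_{t=1}^n |z_t| · 1{−S ≤ z_t ≤ S}. -/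

import Mathlib

/-- The check (tick-loss) function `ρ_α(x) = (α − 1{x ≤ 0})·x`. -/
noncomputable def checkFun (α x : ℝ) : ℝ := (α - if x ≤ 0 then 1 else 0) * x

/-- The check function is `1`-Lipschitz for `α ∈ [0, 1]`. -/
theorem abs_checkFun_sub_le {α : ℝ} (hα : α ∈ Set.Icc (0 : ℝ) 1) (x y : ℝ) :
    |checkFun α x - checkFun α y| ≤ |x - y| := by
  obtain ⟨h0, h1⟩ := hα
  have hx : checkFun α x = α * x - min x 0 := by
    unfold checkFun
    split_ifs with h
    · rw [min_eq_left h]; ring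
    · rw [min_eq_right (not_le.mp h).le]; ring
  have hy : checkFun α y = α * y - min y 0 := by
    unfold checkFun
    split_ifs with h
    · rw [min_eq_left h]; ring
    · rw [min_eq_right (not_le.mp h).le]; ring
  rw [hx, hy]
  wlog hxy : y ≤ x generalizing x y
  · rw [abs_sub_comm, abs_sub_comm x]
    exact this y x hy hx (le_of_not_ge hxy)
  rw [abs_of_nonneg (sub_nonneg.mpr hxy), abs_le]
  rcases min_cases x 0 with ⟨hmx, _⟩ | ⟨hmx, _⟩ <;>
    rcases min_cases y 0 with ⟨hmy, _⟩ | ⟨hmy, _⟩ <;>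
    rw [hmx, hmy] <;> constructor <;>
    nlinarith [mul_nonneg h0 (sub_nonneg.mpr hxy),
      mul_nonneg (sub_nonneg.mpr h1) (sub_nonneg.mpr hxy)]

/-- The difference between the feasible and infeasible quantile-regression objectives
is bounded by the average size of the measurement errors plus the average of the
residuals truncated to the band `[−S, S]`, where `S` is the maximal measurement error. -/
theorem feasible_infeasible_objective_bound
    (α : ℝ) (hα : α ∈ Set.Icc (0 : ℝ) 1)
    (n : ℕ) (hn : 1 ≤ n)
    (z N Nc Nd : ℕ → ℝ)
    (b₁ b₂ : ℝ) (hb₁ : 0 ≤ b₁) (hb₂ : 0 ≤ b₂)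
    (β₁ β₂ : ℝ) (hβ₁ : |β₁| ≤ b₁) (hβ₂ : |β₂| ≤ b₂)
    (S : ℝ)
    (hS : S = (Finset.Icc 1 n).sup' (Finset.nonempty_Icc.mpr hn)
      fun t => |N t| + b₁ * |Nc t| + b₂ * |Nd t|) :
    |(1 / (n : ℝ)) * ∑ t ∈ Finset.Icc 1 n, checkFun α (z t + N t - β₁ * Nc t - β₂ * Nd t)
      - (1 / (n : ℝ)) * ∑ t ∈ Finset.Icc 1 n, checkFun α (z t)| ≤
      (1 / (n : ℝ)) * ∑ t ∈ Finset.Icc 1 n, (|N t| + b₁ * |Nc t| + b₂ * |Nd t|)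
      + (1 / (n : ℝ)) * ∑ t ∈ Finset.Icc 1 n,
          |z t| * (if -S ≤ z t ∧ z t ≤ S then (1 : ℝ) else 0) := by
  have hn0 : (0 : ℝ) ≤ 1 / (n : ℝ) := by positivity
  have hband : 0 ≤ (1 / (n : ℝ)) * ∑ t ∈ Finset.Icc 1 n,
      |z t| * (if -S ≤ z t ∧ z t ≤ S then (1 : ℝ) else 0) :=
    mul_nonneg hn0 (Finset.sum_nonneg fun t _ => by split_ifs <;> simp)
  refine le_trans ?_ (le_add_of_nonneg_right hband)
  rw [← mul_sub, ← Finset.sum_sub_distrib, abs_mul, abs_of_nonneg hn0]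
  refine mul_le_mul_of_nonneg_left ?_ hn0
  refine (Finset.abs_sum_le_sum_abs _ _).trans (Finset.sum_le_sum fun t _ => ?_)
  calc |checkFun α (z t + N t - β₁ * Nc t - β₂ * Nd t) - checkFun α (z t)|
      ≤ |z t + N t - β₁ * Nc t - β₂ * Nd t - z t| := abs_checkFun_sub_le hα _ _
    _ = |N t - β₁ * Nc t - β₂ * Nd t| := by congr 1; ring
    _ ≤ |N t| + |β₁ * Nc t| + |β₂ * Nd t| :=
      (abs_sub _ _).trans (add_le_add_left (abs_sub _ _) _)
    _ ≤ |N t| + b₁ * |Nc t| + b₂ * |Nd t| := by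
      rw [abs_mul, abs_mul]
      gcongr
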